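/- arXiv:2308.00501 — 8 statements merged into one kernel-verified Lean document; each statement's English description precedes it below -/
import Mathlib

section
/- Let G be a d-degenerate finite simple graph, let k ≥ 1 be an integer, and let X be a set of at least (4d+2)·k vertices of G. Then the number of vertices v of G that are adjacent to at least |X|/k vertices of X (i.e., vertices v with k·|N(v) ∩ X| ≥ |X|) is at most (4d+2)·k. -/
/-- `G` is `d`-degenerate: every nonempty (induced) subgraph has a vertex of degree at
most `d`. -/
def Degenerate {V : Type*} [Fintype V] [DecidableEq V]
    (G : SimpleGraph V) [DecidableRel G.Adj] (d : ℕ) : Prop :=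
  ∀ A : Finset V, A.Nonempty → ∃ v ∈ A, (G.neighborFinset v ∩ A).card ≤ d

/-- In a `d`-degenerate graph the degrees inside any vertex set `A` sum to at
most `2 * d * A.card`. -/
theorem Degenerate.sum_card_neighborFinset_inter_le {V : Type*} [Fintype V] [DecidableEq V]
    {G : SimpleGraph V} [DecidableRel G.Adj] {d : ℕ} (hG : Degenerate G d) (A : Finset V) :
    ∑ v ∈ A, (G.neighborFinset v ∩ A).card ≤ 2 * d * A.card := by
  induction A using Finset.strongInduction with
  | H A ih =>
    rcases A.eq_empty_or_nonempty with rfl | hA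
    · simp
    obtain ⟨v, hv, hd⟩ := hG A hA
    have hle : ∀ u ∈ A.erase v, (G.neighborFinset u ∩ A).card ≤
        (G.neighborFinset u ∩ A.erase v).card + if G.Adj v u then 1 else 0 := by
      intro u _
      rw [Finset.inter_erase]
      split_ifs with h
      · exact Nat.sub_le_iff_le_add.mp Finset.pred_card_le_card_erase
      · rw [Finset.erase_eq_of_notMem (by simp [G.adj_comm u v, h])]
        exact le_rfl
    have hcount : (∑ u ∈ A.erase v, if G.Adj v u then 1 else 0) ≤
        (G.neighborFinset v ∩ A).card := by
      rw [← Finset.card_filter]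
      apply Finset.card_le_card
      intro u
      simp +contextual
    have hrec := ih _ (Finset.erase_ssubset hv)
    have hsum := Finset.sum_le_sum hle
    rw [Finset.sum_add_distrib] at hsum
    rw [← Finset.add_sum_erase _ _ hv, ← Finset.card_erase_add_one hv, mul_add]
    lia

/-- Alon–Gutner: in a `d`-degenerate graph, for any set `X` of at least `(4d+2)k`
vertices (`k ≥ 1`), at most `(4d+2)k` vertices are adjacent to at least `|X|/k`
vertices of `X` (i.e. satisfy `k·|N(v) ∩ X| ≥ |X|`). -/
theorem few_vertices_hit_many {V : Type*} [Fintype V] [DecidableEq V]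
    (G : SimpleGraph V) [DecidableRel G.Adj] (d k : ℕ) (hk : 1 ≤ k)
    (hG : Degenerate G d) (X : Finset V) (hX : (4 * d + 2) * k ≤ X.card) :
    (Finset.univ.filter fun v : V =>
        X.card ≤ k * (G.neighborFinset v ∩ X).card).card ≤ (4 * d + 2) * k := by
  by_contra! h
  obtain ⟨Y, hYS, hY⟩ := Finset.exists_subset_card_eq h.le
  have hlow : Y.card * X.card ≤ k * ∑ v ∈ Y, (G.neighborFinset v ∩ X).card := by
    rw [Finset.mul_sum, ← smul_eq_mul]
    exact Finset.card_nsmul_le_sum _ _ _ fun v hv => (Finset.mem_filter.mp (hYS hv)).2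
  have hmono : ∑ v ∈ Y, (G.neighborFinset v ∩ X).card ≤
      ∑ v ∈ Y ∪ X, (G.neighborFinset v ∩ (Y ∪ X)).card :=
    (Finset.sum_le_sum fun v _ => Finset.card_le_card
      (Finset.inter_subset_inter_left Finset.subset_union_right)).trans
      (Finset.sum_le_sum_of_subset Finset.subset_union_left)
  have hunion : (Y ∪ X).card ≤ 2 * X.card := by
    have := Finset.card_union_le Y X
    lia
  have hup : ∑ v ∈ Y, (G.neighborFinset v ∩ X).card ≤ 2 * d * (2 * X.card) :=
    hmono.trans <| (hG.sum_card_neighborFinset_inter_le _).trans (Nat.mul_le_mul_left _ hunion)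
  have hcombined := hlow.trans (Nat.mul_le_mul_left k hup)
  have hpos : 0 < k * X.card := by
    have : 0 < (4 * d + 2) * k := by positivity
    exact Nat.mul_pos hk (this.trans_le hX)
  rw [hY] at hcombined
  nlinarith
end

section
/- Let G be a finite simple graph, let i ≤ j be positive integers, and let k ≥ 1 be an integer. Let 𝒳 ⊆ 𝒮_G be a nonempty collection of smaller sides of K_{i,j} bicliques of G and let X = ⋃_{X' ∈ 𝒳} X'. Suppose V' is a set of at most k vertices of G such that G − V' contains no biclique K_{i,j} and such that V' ∩ X = ∅. Then there exists a vertex v ∈ V' which has at least |X|/k neighbors in X, i.e., k·|N(v) ∩ X| ≥ |X|. -/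
/-- A biclique `K_{i,j}` in `G`: disjoint vertex sets `S`, `T` with `|S| = i`, `|T| = j`,
and every vertex of `S` adjacent to every vertex of `T` (not necessarily induced).
`S` is called the smaller side. -/
def IsBiclique {V : Type*} (G : SimpleGraph V) (i j : ℕ) (S T : Finset V) : Prop :=
  Disjoint S T ∧ S.card = i ∧ T.card = j ∧ ∀ s ∈ S, ∀ t ∈ T, G.Adj s t

/-- Let `𝒳` be a nonempty collection of smaller sides of `K_{i,j}` bicliques of `G` and
`X` their union. If `V'` is a set of at most `k` vertices (`k ≥ 1`) such that `G − V'`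
contains no biclique `K_{i,j}` and `V' ∩ X = ∅`, then some `v ∈ V'` has at least
`|X|/k` neighbors in `X`, i.e. `k·|N(v) ∩ X| ≥ |X|`. -/
theorem solution_hits_many {V : Type*} [Fintype V] [DecidableEq V]
    (G : SimpleGraph V) [DecidableRel G.Adj] (i j k : ℕ)
    (hi : 1 ≤ i) (hij : i ≤ j) (hk : 1 ≤ k)
    (𝒳 : Finset (Finset V)) (h𝒳ne : 𝒳.Nonempty)
    (h𝒳 : ∀ X' ∈ 𝒳, ∃ T : Finset V, IsBiclique G i j X' T)
    (V' : Finset V) (hcard : V'.card ≤ k)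
    (hsol : ¬ ∃ S T : Finset V, IsBiclique G i j S T ∧ Disjoint (S ∪ T) V')
    (hdisj : Disjoint V' (𝒳.biUnion id)) :
    ∃ v ∈ V', (𝒳.biUnion id).card ≤ k * (G.neighborFinset v ∩ 𝒳.biUnion id).card := by
  classical
  have hit : ∀ X' ∈ 𝒳, ∃ v ∈ V', ∀ x ∈ X', G.Adj v x := by
    intro X' hX'
    obtain ⟨T, hT⟩ := h𝒳 X' hX'
    have hnot : ¬ Disjoint (X' ∪ T) V' := fun h => hsol ⟨X', T, hT, h⟩
    obtain ⟨v, hv, hvV⟩ := Finset.not_disjoint_iff.mp hnot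
    rcases Finset.mem_union.mp hv with hvX | hvT
    · exact absurd (Finset.mem_biUnion.mpr ⟨X', hX', hvX⟩)
        (Finset.disjoint_left.mp hdisj hvV)
    · exact ⟨v, hvV, fun x hx => (hT.2.2.2 x hx v hvT).symm⟩
  have hne : V'.Nonempty := by
    obtain ⟨X', hX'⟩ := h𝒳ne
    obtain ⟨v, hv, -⟩ := hit X' hX'
    exact ⟨v, hv⟩
  set X := 𝒳.biUnion id with hX
  have hcover : X ⊆ V'.biUnion fun v => G.neighborFinset v ∩ X := by
    intro x hx
    obtain ⟨X', hX', hxX'⟩ := Finset.mem_biUnion.mp hx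
    obtain ⟨v, hv, hadj⟩ := hit X' hX'
    exact Finset.mem_biUnion.mpr ⟨v, hv, Finset.mem_inter.mpr
      ⟨(G.mem_neighborFinset v x).mpr (hadj x hxX'), hx⟩⟩
  have hsum : X.card ≤ ∑ v ∈ V', (G.neighborFinset v ∩ X).card :=
    (Finset.card_le_card hcover).trans Finset.card_biUnion_le
  by_contra! hlt
  have hstrict := Finset.sum_lt_sum_of_nonempty hne hlt
  rw [← Finset.mul_sum, Finset.sum_const, smul_eq_mul] at hstrict
  exact absurd ((Nat.mul_le_mul_right _ hcard).trans (Nat.mul_le_mul_left k hsum))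
    hstrict.not_ge
end

section
/- Let G be a d-degenerate finite simple graph, let i ≤ j be positive integers, and let k ≥ 1 be an integer. Suppose the instance (G,k,i,j) of Biclique-Free Vertex Deletion is a yes-instance and that |⋃_{S ∈ 𝒮_G} S| > (4d+2)·k. Then there exists a set W of at most (8d+4)·k + i vertices of G such that every solution V' of (G,k,i,j) satisfies V' ∩ W ≠ ∅. -/
/-- In a `d`-degenerate graph there are at most `d (|X| + |Y|)` edges between disjoint `X`, `Y`. -/
theorem Degenerate.sum_adj_le {V : Type*} [Fintype V] [DecidableEq V]
    {G : SimpleGraph V} [DecidableRel G.Adj] {d : ℕ} (hG : Degenerate G d)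
    (X Y : Finset V) (hXY : Disjoint X Y) :
    ∑ x ∈ X, ∑ y ∈ Y, (if G.Adj x y then 1 else 0) ≤ d * (X.card + Y.card) := by
  induction hn : X.card + Y.card generalizing X Y with
  | zero =>
    have hX : X = ∅ := Finset.card_eq_zero.1 (by omega)
    simp [hX]
  | succ n ih =>
    have hne : (X ∪ Y).Nonempty := by
      rw [← Finset.card_pos, Finset.card_union_of_disjoint hXY]
      omega
    obtain ⟨v, hv, hdeg⟩ := hG _ hne
    have key : ∀ Z ⊆ X ∪ Y, ∑ z ∈ Z, (if G.Adj v z then 1 else 0) ≤ d := by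
      intro Z hZ
      rw [Finset.sum_boole, Nat.cast_id]
      refine le_trans (Finset.card_le_card fun z hz => ?_) hdeg
      rw [Finset.mem_filter] at hz
      exact Finset.mem_inter.2 ⟨(G.mem_neighborFinset v z).2 hz.2, hZ hz.1⟩
    rcases Finset.mem_union.1 hv with hvX | hvY
    · have hcard := Finset.card_erase_add_one hvX
      have hrec := ih (X.erase v) Y (hXY.mono_left (Finset.erase_subset _ _)) (by omega)
      rw [← Finset.sum_erase_add _ _ hvX]
      have := key Y Finset.subset_union_right
      linarith
    · have hcard := Finset.card_erase_add_one hvY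
      have hrec := ih X (Y.erase v) (hXY.mono_right (Finset.erase_subset _ _)) (by omega)
      have hsplit : ∑ x ∈ X, ∑ y ∈ Y, (if G.Adj x y then 1 else 0) =
          ∑ x ∈ X, ∑ y ∈ Y.erase v, (if G.Adj x y then 1 else 0) +
            ∑ x ∈ X, (if G.Adj v x then 1 else 0) := by
        rw [← Finset.sum_add_distrib]
        refine Finset.sum_congr rfl fun x _ => ?_
        rw [← Finset.sum_erase_add _ _ hvY]
        simp only [G.adj_comm x v]
      rw [hsplit]
      have := key X Finset.subset_union_left
      linarith

/-- A biclique `K_{i,j}` with `1 ≤ i ≤ j` in a `d`-degenerate graph has `i ≤ d`. -/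
theorem Degenerate.le_of_isBiclique {V : Type*} [Fintype V] [DecidableEq V]
    {G : SimpleGraph V} [DecidableRel G.Adj] {d i j : ℕ} (hG : Degenerate G d)
    (hi : 1 ≤ i) (hij : i ≤ j) {S T : Finset V} (h : IsBiclique G i j S T) : i ≤ d := by
  obtain ⟨-, hS, hT, hadj⟩ := h
  have hne : (S ∪ T).Nonempty :=
    (Finset.card_pos.1 (by omega : 0 < S.card)).mono Finset.subset_union_left
  obtain ⟨v, hv, hdeg⟩ := hG _ hne
  rcases Finset.mem_union.1 hv with hvS | hvT
  · have : T ⊆ G.neighborFinset v ∩ (S ∪ T) := fun t ht =>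
      Finset.mem_inter.2 ⟨(G.mem_neighborFinset v t).2 (hadj v hvS t ht),
        Finset.mem_union_right _ ht⟩
    have := Finset.card_le_card this
    omega
  · have : S ⊆ G.neighborFinset v ∩ (S ∪ T) := fun s hs =>
      Finset.mem_inter.2 ⟨(G.mem_neighborFinset v s).2 (hadj s hs v hvT).symm,
        Finset.mem_union_left _ hs⟩
    have := Finset.card_le_card this
    omega

/-- If the `i`-element sets satisfying `P` cover at least `n` points, then some union of such
sets has between `n` and `n + i - 1` points. -/
theorem exists_union_card_between {V : Type*} [Fintype V] [DecidableEq V]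
    {P : Finset V → Prop} {i : ℕ} (hi : 1 ≤ i) (hP : ∀ S, P S → S.card = i) (n : ℕ)
    (hn : n ≤ {v : V | ∃ S, P S ∧ v ∈ S}.ncard) :
    ∃ U : Finset V, n ≤ U.card ∧ U.card + 1 ≤ n + i ∧
      ∀ u ∈ U, ∃ S, P S ∧ u ∈ S ∧ S ⊆ U := by
  induction n with
  | zero => exact ⟨∅, by simp, by simpa using hi, by simp⟩
  | succ n ih =>
    obtain ⟨U, hnU, hUn, hU⟩ := ih (by omega)
    by_cases hlt : n + 1 ≤ U.card
    · exact ⟨U, hlt, by omega, hU⟩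
    obtain ⟨v, ⟨S, hS, hvS⟩, hvU⟩ :=
      Set.exists_mem_notMem_of_ncard_lt_ncard (s := (U : Set V))
        (t := {v : V | ∃ S, P S ∧ v ∈ S}) (by rw [Set.ncard_coe_finset]; omega)
    refine ⟨U ∪ S, ?_, ?_, fun u hu => ?_⟩
    · have hlt' : U.card < (U ∪ S).card := Finset.card_lt_card <|
        (Finset.ssubset_iff_of_subset Finset.subset_union_left).2
          ⟨v, Finset.mem_union_right _ hvS, by simpa using hvU⟩
      omega
    · have := Finset.card_union_le U S
      rw [hP S hS] at this
      omega
    · rcases Finset.mem_union.1 hu with hu | hu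
      · obtain ⟨R, hR, huR, hRU⟩ := hU u hu
        exact ⟨R, hR, huR, hRU.trans Finset.subset_union_left⟩
      · exact ⟨S, hS, hu, Finset.subset_union_right⟩

/-- If `(G,k,i,j)` is a yes-instance of Biclique-Free Vertex Deletion on a `d`-degenerate
graph and the union of smaller sides of all bicliques has more than `(4d+2)k` vertices,
then there is a set `W` of at most `(8d+4)k + i` vertices intersecting every solution. -/
theorem branching_set_exists {V : Type*} [Fintype V] [DecidableEq V]
    (G : SimpleGraph V) [DecidableRel G.Adj] (d i j k : ℕ)
    (hi : 1 ≤ i) (hij : i ≤ j) (hk : 1 ≤ k) (hG : Degenerate G d)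
    (hyes : ∃ V' : Finset V, V'.card ≤ k ∧
      ¬ ∃ S T : Finset V, IsBiclique G i j S T ∧ Disjoint (S ∪ T) V')
    (hss : (4 * d + 2) * k <
      {v : V | ∃ S T : Finset V, IsBiclique G i j S T ∧ v ∈ S}.ncard) :
    ∃ W : Finset V, W.card ≤ (8 * d + 4) * k + i ∧
      ∀ V' : Finset V, V'.card ≤ k →
        (¬ ∃ S T : Finset V, IsBiclique G i j S T ∧ Disjoint (S ∪ T) V') →
        (V' ∩ W).Nonempty := by
  have hset : {v : V | ∃ S T : Finset V, IsBiclique G i j S T ∧ v ∈ S} =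
      {v : V | ∃ S, (∃ T, IsBiclique G i j S T) ∧ v ∈ S} := by
    ext v
    simp
  rw [hset] at hss
  obtain ⟨U, hnU, hUn, hU⟩ := exists_union_card_between hi
    (fun S ⟨T, hST⟩ => hST.2.1) ((4 * d + 2) * k + 1) hss
  have hid : i ≤ d := by
    obtain ⟨u, hu⟩ := Finset.card_pos.1 (by omega : 0 < U.card)
    obtain ⟨S, ⟨T, hST⟩, -⟩ := hU u hu
    exact hG.le_of_isBiclique hi hij hST
  let H : Finset V := Finset.univ.filter fun v =>
    v ∉ U ∧ 4 * d + 3 ≤ ∑ u ∈ U, (if G.Adj v u then 1 else 0)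
  have hHU : Disjoint H U := Finset.disjoint_left.2 fun v hv => (Finset.mem_filter.1 hv).2.1
  have hedge := hG.sum_adj_le H U hHU
  have hmul : H.card * (4 * d + 3) ≤ d * (H.card + U.card) :=
    le_trans (Finset.card_nsmul_le_sum H _ _ fun v hv => (Finset.mem_filter.1 hv).2.2) hedge
  have hHcard : 3 * H.card ≤ U.card := by
    by_contra! hlt
    nlinarith
  have hdk : d ≤ d * k := Nat.le_mul_of_pos_right d hk
  refine ⟨U ∪ H, ?_, fun V' hV' hsol => ?_⟩
  · have := Finset.card_union_le U H
    have h1 : (4 * d + 2) * k = 4 * (d * k) + 2 * k := by ring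
    have h2 : (8 * d + 4) * k = 8 * (d * k) + 4 * k := by ring
    omega
  · rw [← Finset.not_disjoint_iff_nonempty_inter]
    intro hdisj
    have hV'U : Disjoint V' U := hdisj.mono_right Finset.subset_union_left
    have hhit : ∀ u ∈ U, 1 ≤ ∑ v ∈ V', (if G.Adj v u then 1 else 0) := by
      intro u hu
      obtain ⟨S, ⟨T, hST⟩, huS, hSU⟩ := hU u hu
      have hT : ¬ Disjoint T V' := fun hT =>
        hsol ⟨S, T, hST, Finset.disjoint_union_left.2 ⟨(hV'U.mono_right hSU).symm, hT⟩⟩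
      obtain ⟨t, htT, htV⟩ := Finset.not_disjoint_iff.1 hT
      refine le_trans ?_ (Finset.single_le_sum (fun _ _ => Nat.zero_le _) htV)
      rw [if_pos (hST.2.2.2 u huS t htT).symm]
    have hsum : U.card ≤ ∑ v ∈ V', ∑ u ∈ U, (if G.Adj v u then 1 else 0) := by
      rw [Finset.sum_comm]
      simpa using Finset.card_nsmul_le_sum U _ 1 hhit
    have hVk : V'.card * (4 * d + 2) ≤ (4 * d + 2) * k := by
      rw [mul_comm]
      exact Nat.mul_le_mul_left _ hV'
    obtain ⟨v, hv, hlt⟩ : ∃ v ∈ V', 4 * d + 2 < ∑ u ∈ U, (if G.Adj v u then 1 else 0) := by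
      refine Finset.exists_lt_of_sum_lt ?_
      rw [Finset.sum_const, smul_eq_mul]
      omega
    have hvH : v ∈ H :=
      Finset.mem_filter.2 ⟨Finset.mem_univ v, Finset.disjoint_left.1 hV'U hv, hlt⟩
    exact Finset.disjoint_left.1 hdisj hv (Finset.mem_union_right _ hvH)
end

section
/- Let G be a finite simple graph in which every vertex has degree at least two, and let F ⊆ E(G) be a set of edges such that the graph obtained from G by deleting the edges in F is acyclic (a forest). Then the number of vertices of G of degree at least three is at most 2·|F| − 2. -/
/-- A forest on a nonempty vertex set has fewer edges than vertices. -/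
theorem SimpleGraph.IsAcyclic.card_edgeFinset_add_one_le {V : Type*} [Fintype V] [Nonempty V]
    {H : SimpleGraph V} [Fintype H.edgeSet] (hH : H.IsAcyclic) :
    H.edgeFinset.card + 1 ≤ Fintype.card V := by
  classical
  obtain ⟨T, hHT, -, hT⟩ :=
    SimpleGraph.connected_top.exists_isTree_le_of_le_of_isAcyclic (le_top : H ≤ ⊤) hH
  rw [← hT.card_edgeFinset]
  gcongr

/-- If every vertex of `G` has degree at least two and `F` is a feedback edge set of `G`
(i.e. removing the edges of `F` leaves a forest), then the number of vertices of degree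
at least three is at most `2|F| − 2`. -/
theorem high_degree_vertices_bound {V : Type*} [Fintype V] [DecidableEq V]
    (G : SimpleGraph V) [DecidableRel G.Adj]
    (hmin : ∀ v : V, 2 ≤ G.degree v)
    (F : Finset (Sym2 V)) (hF : ↑F ⊆ G.edgeSet)
    (hforest : (G.deleteEdges ↑F).IsAcyclic) :
    (Finset.univ.filter fun v : V => 3 ≤ G.degree v).card ≤ 2 * F.card - 2 := by
  classical
  cases isEmpty_or_nonempty V
  · simp
  have hforest_card := hforest.card_edgeFinset_add_one_le
  rw [SimpleGraph.edgeFinset_deleteEdges] at hforest_card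
  have hsdiff := Finset.le_card_sdiff F G.edgeFinset
  have hdegree_sum := G.sum_degrees_eq_twice_card_edges
  have hdegree_lower : ∑ v : V, (2 + if 3 ≤ G.degree v then 1 else 0) ≤ ∑ v, G.degree v := by
    refine Finset.sum_le_sum fun v _ ↦ ?_
    have := hmin v
    split_ifs <;> omega
  rw [Finset.sum_add_distrib, ← Finset.card_filter] at hdegree_lower
  simp only [Finset.sum_const, Finset.card_univ, smul_eq_mul] at hdegree_lower
  omega
end

section
/- Let G be a finite simple graph, let i ≤ j be integers with i ≥ 2, and let (v₁, v₂, v₃, v₄, v₅) be a path on five distinct vertices of G (so v₁v₂, v₂v₃, v₃v₄, v₄v₅ are edges) such that v₂, v₃ and v₄ each have degree exactly 2 in G. Then v₃ is not part of any biclique K_{i,j} of G; that is, for every biclique (S,T) of G, v₃ ∉ S ∪ T. -/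
/-- The neighbours of a vertex of degree two are any two distinct vertices adjacent to it. -/
theorem SimpleGraph.neighborFinset_eq_pair_of_degree_eq_two {V : Type*} [DecidableEq V]
    {G : SimpleGraph V} {v a b : V} [Fintype (G.neighborSet v)] (hd : G.degree v = 2)
    (ha : G.Adj v a) (hb : G.Adj v b) (hab : a ≠ b) : G.neighborFinset v = {a, b} := by
  symm
  apply Finset.eq_of_subset_of_card_le
  · simp [Finset.insert_subset_iff, ha, hb]
  · rw [G.card_neighborFinset_eq_degree, hd, Finset.card_pair hab]

theorem IsBiclique.symm {V : Type*} {G : SimpleGraph V} {i j : ℕ} {S T : Finset V}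
    (h : IsBiclique G i j S T) : IsBiclique G j i T S :=
  ⟨h.1.symm, h.2.2.1, h.2.1, fun t ht s hs => (h.2.2.2 s hs t ht).symm⟩

/-- If the neighbours of `v` are `a` and `b`, and `v` is the only common neighbour of `a` and `b`,
then `v` lies in no left side of a biclique whose two sides have size at least two. -/
theorem IsBiclique.notMem_left {V : Type*} [DecidableEq V] {G : SimpleGraph V} {i j : ℕ}
    {S T : Finset V} (h : IsBiclique G i j S T) (hi : 2 ≤ i) (hj : 2 ≤ j) {v a b : V}
    (hv : ∀ x, G.Adj v x → x = a ∨ x = b)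
    (hab : ∀ x, G.Adj a x → G.Adj b x → x = v) : v ∉ S := by
  obtain ⟨-, rfl, rfl, hadj⟩ := h
  intro hvS
  have hT : T = {a, b} := by
    apply Finset.eq_of_subset_of_card_le
    · intro x hx
      simpa using hv x (hadj v hvS x hx)
    · exact Finset.card_le_two.trans hj
  obtain ⟨x, hx, hxv⟩ := Finset.exists_mem_ne hi v
  exact hxv (hab x (hadj x hx a (by simp [hT])).symm (hadj x hx b (by simp [hT])).symm)

/-- For `i ≥ 2`: if `(v₁, v₂, v₃, v₄, v₅)` is a path on five distinct vertices whose
three inner vertices have degree exactly two in `G`, then `v₃` is not part of any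
biclique `K_{i,j}` of `G`. -/
theorem middle_of_path_not_in_biclique {V : Type*} [Fintype V] [DecidableEq V]
    (G : SimpleGraph V) [DecidableRel G.Adj] (i j : ℕ) (hi : 2 ≤ i) (hij : i ≤ j)
    (v₁ v₂ v₃ v₄ v₅ : V)
    (hdist : List.Pairwise (· ≠ ·) [v₁, v₂, v₃, v₄, v₅])
    (h12 : G.Adj v₁ v₂) (h23 : G.Adj v₂ v₃) (h34 : G.Adj v₃ v₄) (h45 : G.Adj v₄ v₅)
    (hd2 : G.degree v₂ = 2) (hd3 : G.degree v₃ = 2) (hd4 : G.degree v₄ = 2) :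
    ∀ S T : Finset V, IsBiclique G i j S T → v₃ ∉ S ∪ T := by
  simp only [List.pairwise_cons, List.mem_cons, List.not_mem_nil, or_false, forall_eq_or_imp,
    forall_eq] at hdist
  obtain ⟨⟨-, h13, -, h15⟩, ⟨-, h24, -⟩, ⟨-, h35⟩, -⟩ := hdist
  have n2 := SimpleGraph.neighborFinset_eq_pair_of_degree_eq_two hd2 h12.symm h23 h13
  have n3 := SimpleGraph.neighborFinset_eq_pair_of_degree_eq_two hd3 h23.symm h34 h24
  have n4 := SimpleGraph.neighborFinset_eq_pair_of_degree_eq_two hd4 h34.symm h45 h35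
  simp only [Finset.ext_iff, SimpleGraph.mem_neighborFinset, Finset.mem_insert,
    Finset.mem_singleton] at n2 n3 n4
  have hcommon : ∀ x, G.Adj v₂ x → G.Adj v₄ x → x = v₃ := by grind
  intro S T h
  rw [Finset.mem_union, not_or]
  exact ⟨h.notMem_left hi (hi.trans hij) (fun x => (n3 x).1) hcommon,
    h.symm.notMem_left (hi.trans hij) hi (fun x => (n3 x).1) hcommon⟩
end

section
/- Let (G, k, r, w) be an instance of Weighted Bounded-Degree Deletion and let v be a vertex with deg_G(v) + w_v ≤ r. Let w' be any weight function agreeing with w on all vertices other than v and satisfying 0 ≤ w'_v ≤ r − deg_G(v). Then a vertex set V' is a WBDD-solution for (G, k, r, w) if and only if V' is a WBDD-solution for (G, k, r, w'). In particular, increasing w_v by one when deg_G(v) + w_v < r yields an equivalent instance. -/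
/-- A WBDD-solution of the instance `(G, k, r, w)`: a set `V'` of at most `k` vertices
such that every vertex `v ∉ V'` satisfies `deg_{G−V'}(v) + w_v ≤ r`. -/
def IsWBDDSol {V : Type*} [Fintype V] [DecidableEq V]
    (G : SimpleGraph V) [DecidableRel G.Adj] (k r : ℕ) (w : V → ℕ)
    (V' : Finset V) : Prop :=
  V'.card ≤ k ∧ ∀ v, v ∉ V' → (G.neighborFinset v \ V').card + w v ≤ r

theorem isWBDDSol_congr_of_degree_add_le {V : Type*} [Fintype V] [DecidableEq V]
    (G : SimpleGraph V) [DecidableRel G.Adj] (k r : ℕ) {w w' : V → ℕ} {v : V}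
    (hw : G.degree v + w v ≤ r) (hw' : G.degree v + w' v ≤ r)
    (hagree : ∀ u, u ≠ v → w' u = w u) (V' : Finset V) :
    IsWBDDSol G k r w V' ↔ IsWBDDSol G k r w' V' := by
  refine and_congr_right fun _ => forall₂_congr fun u _ => ?_
  rcases eq_or_ne u v with rfl | hu
  · have hcard : (G.neighborFinset u \ V').card ≤ G.degree u :=
      Finset.card_le_card Finset.sdiff_subset
    constructor <;> intro <;> omega
  · rw [hagree u hu]

/-- If `deg_G(v) + w_v ≤ r` and `w'` agrees with `w` off `v` with `w'_v ≤ r − deg_G(v)`,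
then `(G,k,r,w)` and `(G,k,r,w')` have the same WBDD-solutions. In particular, if
`deg_G(v) + w_v < r`, increasing `w_v` by one yields an equivalent instance. -/
theorem wbdd_low_weight_rule {V : Type*} [Fintype V] [DecidableEq V]
    (G : SimpleGraph V) [DecidableRel G.Adj] (k r : ℕ) (w : V → ℕ)
    (v : V) (hv : G.degree v + w v ≤ r)
    (w' : V → ℕ) (hagree : ∀ u, u ≠ v → w' u = w u) (hle : w' v ≤ r - G.degree v) :
    (∀ V' : Finset V, IsWBDDSol G k r w V' ↔ IsWBDDSol G k r w' V') ∧
    (G.degree v + w v < r →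
      ∀ V' : Finset V,
        IsWBDDSol G k r w V' ↔ IsWBDDSol G k r (Function.update w v (w v + 1)) V') := by
  refine ⟨isWBDDSol_congr_of_degree_add_le G k r hv (by omega) hagree, fun hlt => ?_⟩
  refine isWBDDSol_congr_of_degree_add_le G k r hv ?_ fun u hu => Function.update_of_ne hu _ _
  rw [Function.update_self]
  omega
end

section
/- Let (G, k, r, w) be an instance of Weighted Bounded-Degree Deletion with r ≥ 1, and let v be a vertex whose only neighbor is u (i.e., N_G(v) = {u}) with w_v = r − 1. Let G' = G − v and let w' agree with w on all vertices of G' except that w'_u = w_u + 1. Then (G, k, r, w) has a WBDD-solution if and only if (G', k, r, w') has a WBDD-solution. -/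
/-- Deleting from the host graph a vertex `v` that is not adjacent to `x` does not change
the neighborhood of `x`. -/
theorem neighborFinset_inter_erase_of_not_adj {V : Type*} [Fintype V] [DecidableEq V]
    (G : SimpleGraph V) [DecidableRel G.Adj] {v x : V} (h : ¬ G.Adj x v) :
    G.neighborFinset x ∩ Finset.univ.erase v = G.neighborFinset x ∩ Finset.univ := by
  ext y
  have : G.Adj x y → y ≠ v := by rintro hy rfl; exact h hy
  simpa using this

/-- Deleting from the host graph a neighbor `v` of `x` outside `S` lowers the number of
neighbors of `x` outside `S` by one. -/
theorem card_neighborFinset_sdiff_of_adj {V : Type*} [Fintype V] [DecidableEq V]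
    (G : SimpleGraph V) [DecidableRel G.Adj] {v x : V} {S : Finset V} (h : G.Adj x v)
    (hv : v ∉ S) :
    ((G.neighborFinset x ∩ Finset.univ) \ S).card =
      ((G.neighborFinset x ∩ Finset.univ.erase v) \ S).card + 1 := by
  have hmem : v ∈ (G.neighborFinset x ∩ Finset.univ) \ S := by simp [h, hv]
  rw [← Finset.card_erase_add_one hmem]
  congr 2
  ext y
  simp
  tauto


/-- A WBDD-solution of the instance `(G[A], k, r, w)`, where `A` is the current vertex
set (so `G[A]` represents the graph after deleting the vertices outside `A`): a set
`V' ⊆ A` of at most `k` vertices such that every remaining vertex `v ∈ A ∖ V'`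
satisfies `deg_{G[A]−V'}(v) + w_v ≤ r`. -/
def IsWBDDSolOn {V : Type*} [Fintype V] [DecidableEq V]
    (G : SimpleGraph V) [DecidableRel G.Adj] (A : Finset V) (k r : ℕ) (w : V → ℕ)
    (V' : Finset V) : Prop :=
  V' ⊆ A ∧ V'.card ≤ k ∧
    ∀ v ∈ A, v ∉ V' → ((G.neighborFinset v ∩ A) \ V').card + w v ≤ r

/-- Degree-one rule, first case: if `N_G(v) = {u}`, `w_v = r − 1` and `r ≥ 1`, then
`(G, k, r, w)` has a WBDD-solution iff `(G − v, k, r, w')` has one, where `w'` agrees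
with `w` except that `w'_u = w_u + 1`. -/
theorem wbdd_degree_one_rule {V : Type*} [Fintype V] [DecidableEq V]
    (G : SimpleGraph V) [DecidableRel G.Adj] (k r : ℕ) (w : V → ℕ)
    (hr : 1 ≤ r) (v u : V) (hN : G.neighborFinset v = {u}) (hw : w v = r - 1) :
    (∃ V' : Finset V, IsWBDDSolOn G Finset.univ k r w V') ↔
    (∃ V' : Finset V,
      IsWBDDSolOn G (Finset.univ.erase v) k r (Function.update w u (w u + 1)) V') := by
  have hadj : ∀ x, G.Adj x v ↔ x = u := fun x => by
    rw [G.adj_comm, ← G.mem_neighborFinset, hN, Finset.mem_singleton]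
  have huv : u ≠ v := ((hadj u).2 rfl).ne
  constructor
  · rintro ⟨S, -, hk, hS⟩
    by_cases hv : v ∈ S
    · refine ⟨insert u (S.erase v), ?_, ?_, ?_⟩
      · intro x hx
        simp only [Finset.mem_insert, Finset.mem_erase] at hx
        rcases hx with rfl | hx
        · simpa using huv
        · simpa using hx.1
      · have := Finset.card_insert_le u (S.erase v)
        rw [Finset.card_erase_add_one hv] at this
        exact this.trans hk
      · intro x hx hxS
        simp only [Finset.mem_insert, Finset.mem_erase, Finset.mem_univ] at hx hxS
        have hxu : x ≠ u := fun h => hxS (Or.inl h)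
        have hxS' : x ∉ S := fun h => hxS (Or.inr ⟨hx.1, h⟩)
        rw [Function.update_of_ne hxu]
        refine le_trans (Nat.add_le_add_right (Finset.card_le_card ?_) _)
          (hS x (Finset.mem_univ x) hxS')
        intro y
        simp
        tauto
    · refine ⟨S, ?_, hk, ?_⟩
      · exact fun x hx => Finset.mem_erase.2 ⟨fun h => hv (h ▸ hx), Finset.mem_univ x⟩
      · intro x _ hxS
        have hx := hS x (Finset.mem_univ x) hxS
        by_cases hxu : x = u
        · subst hxu
          rw [card_neighborFinset_sdiff_of_adj G ((hadj x).2 rfl) hv] at hx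
          rw [Function.update_self]
          omega
        · rwa [Function.update_of_ne hxu,
            neighborFinset_inter_erase_of_not_adj G (mt (hadj x).1 hxu)]
  · rintro ⟨S, hSA, hk, hS⟩
    have hv : v ∉ S := fun h => (Finset.mem_erase.1 (hSA h)).1 rfl
    refine ⟨S, Finset.subset_univ S, hk, fun x _ hxS => ?_⟩
    by_cases hxv : x = v
    · subst hxv
      have : ((G.neighborFinset x ∩ Finset.univ) \ S).card ≤ 1 := by
        rw [hN, Finset.inter_univ]
        exact Finset.card_le_card Finset.sdiff_subset
      omega
    · have hx := hS x (Finset.mem_erase.2 ⟨hxv, Finset.mem_univ x⟩) hxS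
      by_cases hxu : x = u
      · subst hxu
        rw [Function.update_self] at hx
        rw [card_neighborFinset_sdiff_of_adj G ((hadj x).2 rfl) hv]
        omega
      · rwa [Function.update_of_ne hxu,
          neighborFinset_inter_erase_of_not_adj G (mt (hadj x).1 hxu)] at hx
end

section
/- Let (G, k, r, w) be an instance of Weighted Bounded-Degree Deletion with k ≥ 1, and let v be a vertex whose only neighbor is u (i.e., N_G(v) = {u}) with w_v = r. Then (G, k, r, w) has a WBDD-solution if and only if (G − {u, v}, k − 1, r, w restricted to V(G) ∖ {u, v}) has a WBDD-solution. -/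
/-- Degree-one rule, second case: if `N_G(v) = {u}`, `w_v = r` and `k ≥ 1`, then
`(G, k, r, w)` has a WBDD-solution iff `(G − {u, v}, k − 1, r, w)` has one. -/
theorem wbdd_degree_one_rule_full {V : Type*} [Fintype V] [DecidableEq V]
    (G : SimpleGraph V) [DecidableRel G.Adj] (k r : ℕ) (w : V → ℕ)
    (hk : 1 ≤ k) (v u : V) (hN : G.neighborFinset v = {u}) (hw : w v = r) :
    (∃ V' : Finset V, IsWBDDSolOn G Finset.univ k r w V') ↔
    (∃ V' : Finset V, IsWBDDSolOn G (Finset.univ \ {u, v}) (k - 1) r w V') := by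
  have adj_iff (x : V) : G.Adj v x ↔ x = u := by
    rw [← G.mem_neighborFinset, hN, Finset.mem_singleton]
  constructor
  · rintro ⟨S, -, hcard, hdeg⟩
    have hmem : u ∈ S ∨ v ∈ S := by
      by_contra! h
      have hv := hdeg v (Finset.mem_univ v) h.2
      rw [hN, Finset.inter_univ, Finset.sdiff_eq_self_of_disjoint
        (Finset.disjoint_singleton_left.2 h.1), Finset.card_singleton] at hv
      omega
    refine ⟨S \ {u, v}, Finset.sdiff_subset_sdiff (Finset.subset_univ S) le_rfl, ?_, ?_⟩
    · have hlt : (S \ {u, v}).card < S.card := by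
        refine Finset.card_lt_card (Finset.ssubset_iff_subset_ne.2
          ⟨Finset.sdiff_subset, fun h => ?_⟩)
        rcases hmem with h' | h' <;> rw [← h] at h' <;> simp at h'
      omega
    · intro x hx hxS
      have hxS' : x ∉ S := fun h =>
        hxS (Finset.mem_sdiff.2 ⟨h, (Finset.mem_sdiff.1 hx).2⟩)
      refine le_trans (Nat.add_le_add_right (Finset.card_le_card ?_) _)
        (hdeg x (Finset.mem_univ x) hxS')
      intro y hy
      simp only [Finset.mem_sdiff, Finset.mem_inter, Finset.mem_univ, true_and, and_true] at hy ⊢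
      tauto
  · rintro ⟨S, -, hcard, hdeg⟩
    refine ⟨insert u S, Finset.subset_univ _, ?_, ?_⟩
    · have := Finset.card_insert_le u S
      omega
    · intro x _ hx
      rw [Finset.mem_insert, not_or] at hx
      by_cases hxv : x = v
      · subst hxv
        simp [hN, hw]
      · refine le_trans (Nat.add_le_add_right (Finset.card_le_card ?_) _)
          (hdeg x (by simp [hx.1, hxv]) hx.2)
        intro y hy
        have hyv : y ≠ v := by
          rintro rfl
          simp only [Finset.mem_sdiff, Finset.mem_inter, G.mem_neighborFinset] at hy
          exact hx.1 ((adj_iff x).1 hy.1.1.symm)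
        simp only [Finset.mem_sdiff, Finset.mem_inter, Finset.mem_univ, true_and, and_true,
          Finset.mem_insert, Finset.mem_singleton] at hy ⊢
        tauto
end
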